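/- There do not exist a nowhere-vanishing smooth function m : ℝ³ → ℝ and a nonzero constant vector C ∈ ℝ⁴ such that L₁N(s,t,w) = m(s,t,w)·(N(s,t,w) + C) for all (s,t,w) ∈ ℝ³. In other words, no tubular hypersurface obtained by pseudo hyperspheres whose centers lie on a timelike curve in E⁴₁ has second kind L₁-pointwise 1-type Gauss map. -/

import Mathlib

noncomputable section

open Real

set_option linter.unusedVariables false

/-- Minkowski inner product on `ℝ⁴` with signature `(-,+,+,+)`. -/
def mink (u v : Fin 4 → ℝ) : ℝ :=
  -(u 0 * v 0) + u 1 * v 1 + u 2 * v 2 + u 3 * v 3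

/-- Gauss map of the tubular hypersurface about a timelike curve. -/
def gaussN (F₂ F₃ F₄ : ℝ → Fin 4 → ℝ) (s t w : ℝ) : Fin 4 → ℝ :=
  -((cos t * cos w) • F₂ s + (sin t * cos w) • F₃ s + (sin w) • F₄ s)

/-- The tubular hypersurface about a timelike curve. -/
def tubeT (r : ℝ) (β F₂ F₃ F₄ : ℝ → Fin 4 → ℝ) (s t w : ℝ) : Fin 4 → ℝ :=
  β s + r • ((cos t * cos w) • F₂ s + (sin t * cos w) • F₃ s + (sin w) • F₄ s)

/-- The function `D(s,t,w) = 1 + r k₁(s) cos t cos w`. -/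
def Dfun (r : ℝ) (k₁ : ℝ → ℝ) (s t w : ℝ) : ℝ := 1 + r * k₁ s * cos t * cos w

/-- The Cheng–Yau operator `ℒ₁` applied to the Gauss map of the tubular hypersurface. -/
def L1N (r : ℝ) (k₁ k₂ : ℝ → ℝ) (F₁ F₂ F₃ F₄ : ℝ → Fin 4 → ℝ) (s t w : ℝ) : Fin 4 → ℝ :=
  (-2 * (deriv k₁ s * cos t + k₁ s * k₂ s * sin t) * cos w / (r * (Dfun r k₁ s t w) ^ 3)) • F₁ s
  + (-2 * (r * k₁ s * (3 * r * k₁ s * cos t ^ 3 * cos w ^ 3 + 2 * cos t ^ 2 * cos (2 * w)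
      + cos (2 * t)) + cos t * cos w) / (r ^ 3 * (Dfun r k₁ s t w) ^ 2)) • F₂ s
  + (-2 * (1 + 3 * r * k₁ s * cos t * cos w) * sin t * cos w / (r ^ 3 * Dfun r k₁ s t w)) • F₃ s
  + (-2 * (1 + 3 * r * k₁ s * cos t * cos w) * sin w / (r ^ 3 * Dfun r k₁ s t w)) • F₄ s

/-- The operator `ℒ₂` applied to the Gauss map of the tubular hypersurface. -/
def L2N (r : ℝ) (k₁ k₂ : ℝ → ℝ) (F₁ F₂ F₃ F₄ : ℝ → Fin 4 → ℝ) (s t w : ℝ) : Fin 4 → ℝ :=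
  ((deriv k₁ s * cos t + k₁ s * k₂ s * sin t) * cos w / (r ^ 2 * (Dfun r k₁ s t w) ^ 3)) • F₁ s
  + (k₁ s * ((r * k₁ s / 2) * (24 * r * k₁ s * cos t ^ 4 * cos w ^ 4
      + 12 * cos t ^ 3 * cos (3 * w) + 19 * cos t * cos w + 9 * cos (3 * t) * cos w)
      + 6 * cos t ^ 2 * cos (2 * w) + 3 * cos (2 * t) - 1)
      / (4 * r ^ 3 * (Dfun r k₁ s t w) ^ 3)) • F₂ s
  + (3 * k₁ s * sin t * cos t * cos w ^ 2 / (r ^ 3 * Dfun r k₁ s t w)) • F₃ s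
  + (3 * k₁ s * cos t * sin w * cos w / (r ^ 3 * Dfun r k₁ s t w)) • F₄ s

lemma mink_comm (u v : Fin 4 → ℝ) : mink u v = mink v u := by
  unfold mink; ring

lemma mink_add_left (u v x : Fin 4 → ℝ) : mink (u + v) x = mink u x + mink v x := by
  simp only [mink, Pi.add_apply]; ring

lemma mink_neg_left (u x : Fin 4 → ℝ) : mink (-u) x = -mink u x := by
  simp only [mink, Pi.neg_apply]; ring

lemma mink_smul_left (a : ℝ) (u x : Fin 4 → ℝ) : mink (a • u) x = a * mink u x := by
  simp only [mink, Pi.smul_apply, smul_eq_mul]; ring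

/-- Comparing the `F₂` and `F₄` components at `t = 0` eliminates the proportionality factor. -/
lemma curvature_relation {r a c σ μ : ℝ} (hr : r ≠ 0) (hσ : σ ≠ 0) (hD : 1 + a * c ≠ 0)
    (h₄ : -2 * (1 + 3 * a * c) * σ / (r ^ 3 * (1 + a * c)) = μ * -σ)
    (h₂ : -2 * (a * (3 * a * c ^ 3 + 2 * (2 * c ^ 2 - 1) + 1) + c) / (r ^ 3 * (1 + a * c) ^ 2)
      = μ * (a - c)) :
    a ^ 2 * c * (4 + 3 * a * c) = 0 := by
  have hμ : μ = 2 * (1 + 3 * a * c) / (r ^ 3 * (1 + a * c)) := by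
    apply mul_right_cancel₀ (neg_ne_zero.mpr hσ)
    rw [← h₄]; ring
  rw [hμ] at h₂
  field_simp at h₂
  linear_combination (-1 : ℝ) * h₂

theorem no_second_kind_L1_pointwise_one_type_gauss_map_timelike
    (r : ℝ) (hr : 0 < r)
    (β F₁ F₂ F₃ F₄ : ℝ → Fin 4 → ℝ) (k₁ k₂ k₃ : ℝ → ℝ)
    (hβ : ContDiff ℝ (⊤ : ℕ∞) β) (hF₁ : ContDiff ℝ (⊤ : ℕ∞) F₁) (hF₂ : ContDiff ℝ (⊤ : ℕ∞) F₂)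
    (hF₃ : ContDiff ℝ (⊤ : ℕ∞) F₃) (hF₄ : ContDiff ℝ (⊤ : ℕ∞) F₄)
    (hk₁ : ContDiff ℝ (⊤ : ℕ∞) k₁) (hk₂ : ContDiff ℝ (⊤ : ℕ∞) k₂) (hk₃ : ContDiff ℝ (⊤ : ℕ∞) k₃)
    (hβ' : ∀ s, deriv β s = F₁ s)
    (hF₁₁ : ∀ s, mink (F₁ s) (F₁ s) = -1)
    (hF₂₂ : ∀ s, mink (F₂ s) (F₂ s) = 1)
    (hF₃₃ : ∀ s, mink (F₃ s) (F₃ s) = 1)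
    (hF₄₄ : ∀ s, mink (F₄ s) (F₄ s) = 1)
    (hF₁₂ : ∀ s, mink (F₁ s) (F₂ s) = 0)
    (hF₁₃ : ∀ s, mink (F₁ s) (F₃ s) = 0)
    (hF₁₄ : ∀ s, mink (F₁ s) (F₄ s) = 0)
    (hF₂₃ : ∀ s, mink (F₂ s) (F₃ s) = 0)
    (hF₂₄ : ∀ s, mink (F₂ s) (F₄ s) = 0)
    (hF₃₄ : ∀ s, mink (F₃ s) (F₄ s) = 0)
    (hFr₁ : ∀ s, deriv F₁ s = k₁ s • F₂ s)
    (hFr₂ : ∀ s, deriv F₂ s = k₁ s • F₁ s + k₂ s • F₃ s)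
    (hFr₃ : ∀ s, deriv F₃ s = (-(k₂ s)) • F₂ s + k₃ s • F₄ s)
    (hFr₄ : ∀ s, deriv F₄ s = (-(k₃ s)) • F₃ s)
    (hD : ∀ s t w : ℝ, Dfun r k₁ s t w ≠ 0)
    :
    ¬ ∃ (m : ℝ × ℝ × ℝ → ℝ) (C : Fin 4 → ℝ),
      ContDiff ℝ (⊤ : ℕ∞) m ∧ (∀ p, m p ≠ 0) ∧ C ≠ 0 ∧
        ∀ s t w : ℝ, L1N r k₁ k₂ F₁ F₂ F₃ F₄ s t w
          = m (s, t, w) • (gaussN F₂ F₃ F₄ s t w + C) := by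
  rintro ⟨m, C, -, hm, hC, h⟩
  have hr₀ : r ≠ 0 := hr.ne'
  have comp₂ := fun t w => congrArg (fun v => mink v (F₂ 0)) (h 0 t w)
  have comp₄ := fun t w => congrArg (fun v => mink v (F₄ 0)) (h 0 t w)
  simp only [L1N, gaussN, mink_add_left, mink_neg_left, mink_smul_left, hF₁₂, hF₂₂, hF₁₄, hF₂₄,
    hF₃₄, hF₄₄, mink_comm (F₃ 0) (F₂ 0), mink_comm (F₄ 0) (F₂ 0), hF₂₃, mul_zero, mul_one,
    zero_add, add_zero] at comp₂ comp₄
  have hC₄ : mink C (F₄ 0) = 0 := by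
    simpa [hm] using comp₄ (π / 2) 0
  have hm₀ : m (0, 0, π / 2) = 2 / r ^ 3 := by
    have := comp₄ 0 (π / 2)
    simp [Dfun, hC₄] at this
    linear_combination this
  have hcos : cos (2 * (π / 2)) = -1 := by rw [mul_div_cancel₀ π two_ne_zero, cos_pi]
  have hC₂ : mink C (F₂ 0) = r * k₁ 0 := by
    have := comp₂ 0 (π / 2)
    simp [Dfun, hm₀, hcos] at this
    field_simp at this
    linarith
  have key : ∀ w, sin w ≠ 0 →
      (r * k₁ 0) ^ 2 * cos w * (4 + 3 * (r * k₁ 0) * cos w) = 0 := by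
    intro w hw
    have hDw := hD 0 0 w
    have h₂ := comp₂ 0 w
    have h₄ := comp₄ 0 w
    simp only [Dfun, cos_zero, mul_one, mul_zero, one_mul, one_pow, hC₂, hC₄, cos_two_mul,
      add_zero] at hDw h₂ h₄
    refine curvature_relation (μ := m (0, 0, w)) hr₀ hw hDw ?_ ?_
    · rw [← h₄]; ring
    · rw [show r * k₁ 0 - cos w = -cos w + r * k₁ 0 by ring, ← h₂]; ring
  have hk : k₁ 0 = 0 := by
    have hs : sin (π / 3) ≠ 0 := by rw [sin_pi_div_three]; positivity
    have h₁ := key (π / 3) hs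
    have h₂ := key (π - π / 3) (by rwa [sin_pi_sub])
    rw [cos_pi_sub] at h₂
    rw [cos_pi_div_three] at h₁ h₂
    have : (r * k₁ 0) ^ 3 = 0 := by linear_combination (2 / 3) * h₁ + (2 / 3) * h₂
    simpa [hr₀] using this
  have hmain := h 0 0 (π / 2)
  simp only [L1N, gaussN, Dfun, hk, hm₀] at hmain
  simp at hmain
  apply hC
  have hmC : (2 / r ^ 3) • C = 0 := by
    rw [neg_div, neg_smul, left_eq_add] at hmain
    exact hmain
  exact (smul_eq_zero.mp hmC).resolve_left (by positivity)
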